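/- Let λ be a partition of n, J = J_λ the column stabilizer generating set for tab_λ, and w_J the longest element of W_J. For w ∈ S_n, the Robinson-Schensted correspondence satisfies RS(w) = (t, tab_λ) for some standard tableau t of shape λ if and only if w = v·w_J for some v ∈ S_n with v·tab_λ standard; in that case t = v·tab_λ. -/

import Mathlib

/-- Row insertion of `x` into a row: returns the new row and the bumped entry,
if any. -/
def insRow : List ℕ → ℕ → List ℕ × Option ℕ
  | [], x => ([x], none)
  | a :: as, x =>
      if x < a then (x :: as, some a)
      else
        let p := insRow as x
        (a :: p.1, p.2)

/-- Robinson–Schensted row insertion of `x` into a tableau (list of rows). -/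
def insertT : List (List ℕ) → ℕ → List (List ℕ)
  | [], x => [[x]]
  | r :: rs, x =>
      match insRow r x with
      | (r', none) => r' :: rs
      | (r', some b) => r' :: insertT rs b

/-- Add the label `k` to the recording tableau `q` in the unique new box of the
shape `sh` (the shape of the insertion tableau after the current insertion). -/
def addRec : List (List ℕ) → List ℕ → ℕ → List (List ℕ)
  | [], _, k => [[k]]
  | _ :: _, [], k => [[k]]
  | r :: rs, s :: ss, k =>
      if r.length < s then (r ++ [k]) :: rs else r :: addRec rs ss k

/-- The Robinson–Schensted correspondence: `RS w = (P(w), Q(w))`, obtained by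
row-inserting the entries of the word `w` in order, recording with `1, 2, …`. -/
def RS (w : List ℕ) : List (List ℕ) × List (List ℕ) :=
  (((List.range w.length).map (· + 1)).zip w).foldl
    (fun pq kx =>
      let p' := insertT pq.1 kx.2
      (p', addRec pq.2 (p'.map List.length) kx.1))
    ([], [])

/-- The word (in one-line notation, entries `1, …, n`) of a permutation. -/
def wordOf {n : ℕ} (w : Equiv.Perm (Fin n)) : List ℕ :=
  (List.finRange n).map fun k => (w k : ℕ) + 1

/-- `λ'_j`: the number of parts of `l` that exceed `j` (the conjugate
partition). -/
def conjC (l : List ℕ) (j : ℕ) : ℕ := (l.filter fun x => j < x).length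

/-- `Σ_{h < j} λ'_h`: the number of entries preceding column `j` of the column
superstandard tableau. -/
def colStart (l : List ℕ) (j : ℕ) : ℕ := ((List.range j).map (conjC l)).sum

/-- The column superstandard tableau `tab_λ` (rows as lists): the entry in
cell `(i, j)` is `colStart l j + i + 1`, so columns are filled `1, 2, …`
in order from top to bottom. -/
def tabColList (l : List ℕ) : List (List ℕ) :=
  (List.range l.length).map fun i =>
    (List.range (l.getD i 0)).map fun j => colStart l j + i + 1

/-- The relabelling action of `v ∈ S_n` on a tableau with entries `1, …, n`:
each entry `x` is replaced by `v(x)` (in the `1`-indexed sense). -/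
def actL {n : ℕ} (v : Equiv.Perm (Fin n)) (t : List (List ℕ)) : List (List ℕ) :=
  t.map (List.map fun x => if h : x - 1 < n then (v ⟨x - 1, h⟩ : ℕ) + 1 else x)

/-- A (list-of-rows) tableau is standard: entries increase along each row and
down each column. -/
def standardL (t : List (List ℕ)) : Prop :=
  (∀ r ∈ t, r.Chain' (· < ·)) ∧
  (∀ i j : ℕ, i + 1 < t.length → j < (t.getD (i + 1) []).length →
    (t.getD i []).getD j 0 < (t.getD (i + 1) []).getD j 0)

/-- The number of inversions of a permutation (its Coxeter length). -/
def invLen {n : ℕ} (w : Equiv.Perm (Fin n)) : ℕ :=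
  (Finset.univ.filter fun p : Fin n × Fin n => p.1 < p.2 ∧ w p.2 < w p.1).card

/-- `J_λ`: the simple transpositions `(k, k+1)` (`0`-indexed) such that the
entries `k+1` and `k+2` lie in the same column of `tab_λ`. -/
def JlambdaL (n : ℕ) (l : List ℕ) : Set (Equiv.Perm (Fin n)) :=
  {σ | ∃ (k : ℕ) (hk1 : k + 1 < n),
      (∃ j : ℕ, colStart l j ≤ k ∧ k + 1 < colStart l (j + 1)) ∧
      σ = Equiv.swap ⟨k, by omega⟩ ⟨k + 1, hk1⟩}

/-! ### Conjugate partitions and column starts -/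

theorem conjC_nil (j : ℕ) : conjC [] j = 0 := rfl

theorem conjC_cons (a : ℕ) (l : List ℕ) (j : ℕ) :
    conjC (a :: l) j = (if j < a then 1 else 0) + conjC l j := by
  unfold conjC
  by_cases h : j < a <;> simp [h, Nat.add_comm]

theorem colStart_zero (l : List ℕ) : colStart l 0 = 0 := rfl

theorem colStart_succ (l : List ℕ) (j : ℕ) :
    colStart l (j + 1) = colStart l j + conjC l j := by
  simp [colStart, List.range_succ]

theorem colStart_mono (l : List ℕ) : Monotone (colStart l) :=
  monotone_nat_of_le_succ fun j => by rw [colStart_succ]; omega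

theorem colStart_nil (N : ℕ) : colStart [] N = 0 := by
  induction N with
  | zero => rfl
  | succ N ih => rw [colStart_succ, ih, conjC_nil]

theorem colStart_cons (a : ℕ) (l : List ℕ) (N : ℕ) :
    colStart (a :: l) N = min a N + colStart l N := by
  induction N with
  | zero => simp [colStart_zero]
  | succ N ih =>
    rw [colStart_succ, colStart_succ, ih, conjC_cons]
    split_ifs <;> omega

theorem colStart_eq_sum {l : List ℕ} {N : ℕ} (h : ∀ x ∈ l, x ≤ N) : colStart l N = l.sum := by
  induction l with
  | nil => exact colStart_nil N
  | cons a l ih =>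
    have ha : a ≤ N := h a (by simp)
    rw [colStart_cons, ih fun x hx => h x (by simp [hx]), List.sum_cons]
    omega

theorem lt_conjC_iff {l : List ℕ} (hl : l.Pairwise (· ≥ ·)) (i j : ℕ) :
    i < conjC l j ↔ j < l.getD i 0 := by
  induction l generalizing i with
  | nil => simp [conjC_nil]
  | cons a l ih =>
    rw [List.pairwise_cons] at hl
    obtain ⟨ha, hl⟩ := hl
    rw [conjC_cons]
    cases i with
    | zero =>
      have := ih hl 0
      have h0 : l.getD 0 0 ≤ a := by
        cases l with
        | nil => simp
        | cons b l => exact ha b (by simp)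
      simp only [List.getD_cons_zero]
      split_ifs <;> omega
    | succ i =>
      have := ih hl i
      have h0 : l.getD i 0 ≤ a := by
        by_cases hi : i < l.length
        · rw [List.getD_eq_getElem _ _ hi]
          exact ha _ (List.getElem_mem hi)
        · rw [List.getD_eq_default _ _ (not_lt.mp hi)]
          exact a.zero_le
      simp only [List.getD_cons_succ]
      split_ifs <;> omega

/-! ### Insertion of a whole column -/

/-- Append the entries of a column, from top to bottom, to the rows of a tableau. -/
def glue : List (List ℕ) → List ℕ → List (List ℕ)
  | R, [] => R
  | [], c :: cs => [c] :: glue [] cs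
  | r :: R, c :: cs => (r ++ [c]) :: glue R cs

@[simp] theorem glue_nil_right (R : List (List ℕ)) : glue R [] = R := by
  cases R <;> rfl

theorem length_glue (R : List (List ℕ)) (cs : List ℕ) :
    (glue R cs).length = max R.length cs.length := by
  induction cs generalizing R with
  | nil => simp
  | cons c cs ih => cases R <;> simp [glue, ih]

theorem getD_glue (R : List (List ℕ)) (cs : List ℕ) (i : ℕ) :
    (glue R cs).getD i [] = R.getD i [] ++ cs[i]?.toList := by
  induction cs generalizing R i with
  | nil => simp
  | cons c cs ih =>
    cases R with
    | nil =>
      cases i with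
      | zero => simp [glue]
      | succ i => simpa [glue] using ih [] i
    | cons r R =>
      cases i with
      | zero => simp [glue]
      | succ i => simpa [glue] using ih R i

theorem map_length_glue {R S : List (List ℕ)} {cs es : List ℕ}
    (hRS : R.map List.length = S.map List.length) (h : cs.length = es.length) :
    (glue R cs).map List.length = (glue S es).map List.length := by
  induction cs generalizing R S es with
  | nil =>
    obtain rfl : es = [] := List.length_eq_zero_iff.mp h.symm
    simpa using hRS
  | cons c cs ih =>
    cases es with
    | nil => simp at h
    | cons e es =>
      have hlen : cs.length = es.length := by simpa using h
      cases R with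
      | nil =>
        cases S with
        | nil => simpa [glue] using ih rfl hlen
        | cons s S => simp at hRS
      | cons r R =>
        cases S with
        | nil => simp at hRS
        | cons s S =>
          simp only [List.map_cons, List.cons.injEq] at hRS
          simpa [glue, hRS.1] using ih hRS.2 hlen

/-- The entries of each row of `R` are smaller than the entry of the column `ds` in that row. -/
def RowsLtCol (R : List (List ℕ)) (ds : List ℕ) : Prop :=
  ∀ k d, ds[k]? = some d → ∀ a ∈ R.getD k [], a < d

theorem RowsLtCol.tail {R : List (List ℕ)} {r : List ℕ} {d : ℕ} {ds : List ℕ}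
    (h : RowsLtCol (r :: R) (d :: ds)) : RowsLtCol R ds :=
  fun k e he a ha => h (k + 1) e (by simpa using he) a (by simpa using ha)

theorem RowsLtCol.of_cons {R : List (List ℕ)} {d : ℕ} {ds : List ℕ}
    (h : RowsLtCol R (d :: ds)) (hd : (d :: ds).IsChain (· < ·)) : RowsLtCol R ds := by
  intro k e he a ha
  obtain ⟨hk, rfl⟩ := List.getElem?_eq_some_iff.mp he
  have h1 := List.isChain_iff_getElem.mp hd k (by simpa using hk)
  have h2 := h k _ (List.getElem?_eq_getElem (Nat.lt_succ_of_lt hk)) a ha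
  simp only [List.getElem_cons_succ] at h1
  exact h2.trans h1

theorem insRow_append {r : List ℕ} {x : ℕ} (h : ∀ a ∈ r, a < x) (s : List ℕ) :
    insRow (r ++ s) x = (r ++ (insRow s x).1, (insRow s x).2) := by
  induction r with
  | nil => simp
  | cons a r ih =>
    have ha : ¬ x < a := by have := h a (by simp); omega
    simp [insRow, ha, ih fun b hb => h b (by simp [hb])]

theorem insertT_glue {R : List (List ℕ)} {x : ℕ} {cs : List ℕ}
    (hR : RowsLtCol R (x :: cs)) (hc : (x :: cs).IsChain (· < ·)) :
    insertT (glue R cs) x = glue R (x :: cs) := by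
  induction cs generalizing R x with
  | nil =>
    cases R with
    | nil => rfl
    | cons r R =>
      have := insRow_append (fun a ha => hR 0 x rfl a (by simpa using ha) : ∀ a ∈ r, a < x) []
      simp only [List.append_nil] at this
      simp [insertT, glue, this, insRow]
  | cons c cs ih =>
    have hxc : x < c := by
      have := List.isChain_iff_getElem.mp hc 0 (by simp)
      simpa using this
    cases R with
    | nil =>
      simp only [glue, insertT, insRow, hxc, if_true]
      rw [ih (fun k d _ a ha => by simp at ha) hc.tail]
      rfl
    | cons r R =>
      have := insRow_append (fun a ha => hR 0 x rfl a (by simpa using ha) : ∀ a ∈ r, a < x) [c]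
      simp only [glue, insertT, this, insRow, hxc, if_true]
      rw [ih hR.tail hc.tail]

theorem addRec_glue {R S : List (List ℕ)} {cs es : List ℕ}
    (hRS : R.map List.length = S.map List.length) (h : cs.length = es.length) (x k : ℕ) :
    addRec (glue S es) ((glue R (x :: cs)).map List.length) k = glue S (es ++ [k]) := by
  induction cs generalizing R S es x with
  | nil =>
    obtain rfl : es = [] := List.length_eq_zero_iff.mp h.symm
    cases R with
    | nil =>
      cases S with
      | nil => rfl
      | cons s S => simp at hRS
    | cons r R =>
      cases S with
      | nil => simp at hRS
      | cons s S =>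
        simp only [List.map_cons, List.cons.injEq] at hRS
        simp [glue, addRec, hRS.1]
  | cons c cs ih =>
    cases es with
    | nil => simp at h
    | cons e es =>
      have hlen : cs.length = es.length := by simpa using h
      cases R with
      | nil =>
        cases S with
        | nil => simpa [glue, addRec] using ih (R := []) rfl hlen c
        | cons s S => simp at hRS
      | cons r R =>
        cases S with
        | nil => simp at hRS
        | cons s S =>
          simp only [List.map_cons, List.cons.injEq] at hRS
          simpa [glue, addRec, hRS.1] using ih hRS.2 hlen c

/-! ### The Robinson–Schensted correspondence, one letter at a time -/

theorem RS_nil : RS [] = ([], []) := rfl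

theorem RS_concat (w : List ℕ) (x : ℕ) :
    RS (w ++ [x]) = (insertT (RS w).1 x,
      addRec (RS w).2 ((insertT (RS w).1 x).map List.length) (w.length + 1)) := by
  unfold RS
  rw [List.length_append, List.length_singleton, List.range_succ, List.map_append,
    List.zip_append (by simp), List.foldl_append]
  rfl

theorem RS_append_column {w : List ℕ} {R S : List (List ℕ)} {ds : List ℕ}
    (hw : RS w = (R, S)) (hRS : R.map List.length = S.map List.length)
    (hR : RowsLtCol R ds) (hd : ds.IsChain (· < ·)) :
    RS (w ++ ds.reverse) =
      (glue R ds, glue S ((List.range ds.length).map fun i => w.length + i + 1)) := by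
  induction ds with
  | nil => simpa using hw
  | cons d ds ih =>
    rw [List.reverse_cons, ← List.append_assoc, RS_concat,
      ih (hR.of_cons hd) hd.tail]
    dsimp only
    rw [insertT_glue hR hd, addRec_glue hRS (by simp)]
    simp [List.range_succ]

/-! ### Injectivity -/

theorem mem_insRow {r : List ℕ} {x a : ℕ} (h : a ∈ (insRow r x).1) : a = x ∨ a ∈ r := by
  induction r with
  | nil => simpa [insRow] using h
  | cons b r ih =>
    by_cases hb : x < b
    · simp only [insRow, hb, if_true, List.mem_cons] at h ⊢
      tauto
    · simp only [insRow, hb, if_false, List.mem_cons] at h ⊢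
      tauto

theorem pairwise_insRow {r : List ℕ} (hr : r.Pairwise (· ≤ ·)) (x : ℕ) :
    (insRow r x).1.Pairwise (· ≤ ·) := by
  induction r with
  | nil => simp [insRow]
  | cons b r ih =>
    rw [List.pairwise_cons] at hr
    by_cases hb : x < b
    · simp only [insRow, hb, if_true, List.pairwise_cons]
      exact ⟨fun a ha => hb.le.trans (hr.1 a ha), hr.2⟩
    · simp only [insRow, hb, if_false, List.pairwise_cons]
      refine ⟨fun a ha => ?_, ih hr.2⟩
      rcases mem_insRow ha with rfl | ha
      · exact not_lt.mp hb
      · exact hr.1 a ha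

theorem pairwise_insertT {t : List (List ℕ)} (ht : ∀ r ∈ t, r.Pairwise (· ≤ ·)) (x : ℕ) :
    ∀ r ∈ insertT t x, r.Pairwise (· ≤ ·) := by
  induction t generalizing x with
  | nil => simp [insertT]
  | cons s t ih =>
    have hs := pairwise_insRow (ht s (by simp)) x
    have ht' : ∀ r ∈ t, r.Pairwise (· ≤ ·) := fun r hr => ht r (by simp [hr])
    rcases h : insRow s x with ⟨s', _ | b⟩ <;> rw [h] at hs
    · simp only [insertT, h, List.mem_cons]
      rintro r (rfl | hr)
      exacts [hs, ht' r hr]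
    · simp only [insertT, h, List.mem_cons]
      rintro r (rfl | hr)
      exacts [hs, ih ht' b r hr]

theorem insRow_eq_none {r r' : List ℕ} {x : ℕ} (h : insRow r x = (r', none)) :
    r' = r ++ [x] := by
  induction r generalizing r' with
  | nil => simpa [insRow, eq_comm] using h
  | cons a r ih =>
    by_cases hb : x < a
    · simp [insRow, hb] at h
    · simp only [insRow, hb, if_false, Prod.mk.injEq] at h
      have := ih (r' := (insRow r x).1) (Prod.ext rfl h.2)
      rw [← h.1, this, List.cons_append]

theorem length_insRow_some {r r' : List ℕ} {x b : ℕ} (h : insRow r x = (r', some b)) :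
    r'.length = r.length := by
  induction r generalizing r' with
  | nil => simp [insRow] at h
  | cons a r ih =>
    by_cases hb : x < a
    · simp only [insRow, hb, if_true, Prod.mk.injEq] at h
      simp [← h.1]
    · simp only [insRow, hb, if_false, Prod.mk.injEq] at h
      simp [← h.1, ih (Prod.ext rfl h.2)]

theorem insRow_some_mem {r r' : List ℕ} {x b : ℕ} (h : insRow r x = (r', some b)) :
    b ∈ r ∧ x ∈ r' ∧ x < b := by
  induction r generalizing r' with
  | nil => simp [insRow] at h
  | cons a r ih =>
    by_cases hb : x < a
    · simp only [insRow, hb, if_true, Prod.mk.injEq, Option.some.injEq] at h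
      obtain ⟨rfl, rfl⟩ := h
      simp [hb]
    · simp only [insRow, hb, if_false, Prod.mk.injEq] at h
      obtain ⟨h1, h2, h3⟩ := ih (Prod.ext rfl h.2)
      simp [← h.1, h1, h2, h3]

theorem insRow_some_injective {r s r' : List ℕ} {x y b : ℕ}
    (hr : r.Pairwise (· ≤ ·)) (hs : s.Pairwise (· ≤ ·))
    (h1 : insRow r x = (r', some b)) (h2 : insRow s y = (r', some b)) : r = s ∧ x = y := by
  induction r generalizing s r' with
  | nil => simp [insRow] at h1
  | cons a r ih =>
    cases s with
    | nil => simp [insRow] at h2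
    | cons c s =>
      rw [List.pairwise_cons] at hr hs
      by_cases hxa : x < a <;> by_cases hyc : y < c <;>
        simp only [insRow, hxa, hyc, if_true, if_false, Prod.mk.injEq, Option.some.injEq] at h1 h2
      · obtain ⟨rfl, rfl⟩ := h1
        obtain ⟨h, rfl⟩ := h2
        simp only [List.cons.injEq] at h
        simp [h]
      · obtain ⟨rfl, rfl⟩ := h1
        obtain ⟨h, h'⟩ := h2
        simp only [List.cons.injEq] at h
        obtain ⟨-, hy, hya⟩ := insRow_some_mem (r' := r) (Prod.ext h.2 h')
        have := hr.1 y hy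
        omega
      · obtain ⟨rfl, rfl⟩ := h2
        obtain ⟨h, h'⟩ := h1
        simp only [List.cons.injEq] at h
        obtain ⟨-, hx, hxc⟩ := insRow_some_mem (r' := s) (Prod.ext h.2 h')
        have := hs.1 x hx
        omega
      · obtain ⟨rfl, h1⟩ := h1
        obtain ⟨h, h2⟩ := h2
        simp only [List.cons.injEq] at h
        obtain ⟨rfl, h⟩ := h
        obtain ⟨rfl, rfl⟩ := ih hr.2 hs.2 (Prod.ext rfl h1) (Prod.ext h h2)
        simp

theorem insertT_injective {p q : List (List ℕ)} {x y : ℕ}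
    (hp : ∀ r ∈ p, r.Pairwise (· ≤ ·)) (hq : ∀ r ∈ q, r.Pairwise (· ≤ ·))
    (hpq : p.map List.length = q.map List.length) (h : insertT p x = insertT q y) :
    p = q ∧ x = y := by
  induction p generalizing q x y with
  | nil =>
    cases q with
    | nil => simpa [insertT] using h
    | cons s q => simp at hpq
  | cons r p ih =>
    cases q with
    | nil => simp at hpq
    | cons s q =>
      simp only [List.map_cons, List.cons.injEq] at hpq
      have hp' : ∀ r ∈ p, r.Pairwise (· ≤ ·) := fun r hr => hp r (by simp [hr])
      have hq' : ∀ r ∈ q, r.Pairwise (· ≤ ·) := fun r hr => hq r (by simp [hr])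
      rcases h1 : insRow r x with ⟨r', _ | b⟩ <;> rcases h2 : insRow s y with ⟨s', _ | c⟩ <;>
        simp only [insertT, h1, h2, List.cons.injEq] at h <;> obtain ⟨rfl, h⟩ := h
      · have := (insRow_eq_none h1).symm.trans (insRow_eq_none h2)
        obtain ⟨h3, h4⟩ := List.append_inj this hpq.1
        simp only [List.cons.injEq, and_true] at h4
        simp [h, h3, h4]
      · have := length_insRow_some h2
        rw [insRow_eq_none h1] at this
        simp at this
        omega
      · have := length_insRow_some h1
        rw [insRow_eq_none h2] at this
        simp at this
        omega
      · obtain ⟨rfl, rfl⟩ := ih hp' hq' hpq.2 h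
        obtain ⟨rfl, rfl⟩ := insRow_some_injective (hp r (by simp)) (hq s (by simp)) h1 h2
        simp

theorem map_length_addRec {p q : List (List ℕ)} (h : p.map List.length = q.map List.length)
    (x k : ℕ) :
    (addRec q ((insertT p x).map List.length) k).map List.length =
      (insertT p x).map List.length := by
  induction p generalizing q x with
  | nil =>
    cases q with
    | nil => rfl
    | cons s q => simp at h
  | cons r p ih =>
    cases q with
    | nil => simp at h
    | cons s q =>
      simp only [List.map_cons, List.cons.injEq] at h
      rcases h1 : insRow r x with ⟨r', _ | b⟩
      · simp [insertT, h1, addRec, insRow_eq_none h1, h]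
      · simp [insertT, h1, addRec, length_insRow_some h1, h, ih h.2]

theorem mem_addRec {p q : List (List ℕ)} (h : p.map List.length = q.map List.length)
    {x k : ℕ} {r : List ℕ} (hr : r ∈ addRec q ((insertT p x).map List.length) k) :
    r ∈ q ∨ r = [k] ∨ ∃ s ∈ q, r = s ++ [k] := by
  induction p generalizing q x with
  | nil =>
    cases q with
    | nil => simpa [addRec] using hr
    | cons s q => simp at h
  | cons r p ih =>
    cases q with
    | nil => simp at h
    | cons s q =>
      simp only [List.map_cons, List.cons.injEq] at h
      rcases h1 : insRow r x with ⟨r', _ | b⟩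
      · simp only [insertT, h1, addRec, insRow_eq_none h1, h, List.map_cons, List.length_append,
          List.length_singleton, Nat.lt_succ_self, if_true, List.mem_cons] at hr ⊢
        rcases hr with hr | hr
        · exact .inr (.inr ⟨s, .inl rfl, hr⟩)
        · exact .inl (.inr hr)
      · simp only [insertT, h1, addRec, length_insRow_some h1, h, List.map_cons, lt_irrefl,
          if_false, List.mem_cons] at hr ⊢
        rcases hr with hr | hr
        · exact .inl (.inl hr)
        · rcases ih h.2 hr with h3 | h3 | ⟨u, hu, h3⟩
          exacts [.inl (.inr h3), .inr (.inl h3), .inr (.inr ⟨u, .inr hu, h3⟩)]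

/-- Remove the label `k` from a tableau, dropping the rows that become empty. -/
def eraseLabel (k : ℕ) (q : List (List ℕ)) : List (List ℕ) :=
  (q.map (List.filter (· ≠ k))).filter (· ≠ [])

theorem eraseLabel_cons (k : ℕ) (r : List ℕ) (q : List (List ℕ)) :
    eraseLabel k (r :: q) =
      if r.filter (· ≠ k) = [] then eraseLabel k q else r.filter (· ≠ k) :: eraseLabel k q := by
  unfold eraseLabel
  rw [List.map_cons, List.filter_cons]
  by_cases h : r.filter (· ≠ k) = []
  · rw [if_neg (by simpa using h), if_pos h]
  · rw [if_pos (by simpa using h), if_neg h]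

theorem filter_ne_eq_self {k : ℕ} {r : List ℕ} (h : ∀ a ∈ r, a < k) :
    r.filter (· ≠ k) = r :=
  List.filter_eq_self.mpr fun a ha => by simpa using (h a ha).ne

theorem eraseLabel_eq_self {k : ℕ} {q : List (List ℕ)} (hne : ∀ r ∈ q, r ≠ [])
    (hlt : ∀ r ∈ q, ∀ a ∈ r, a < k) : eraseLabel k q = q := by
  induction q with
  | nil => rfl
  | cons s q ih =>
    rw [eraseLabel_cons, filter_ne_eq_self (hlt s (by simp)), if_neg (hne s (by simp)),
      ih (fun r hr => hne r (by simp [hr])) fun r hr => hlt r (by simp [hr])]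

theorem eraseLabel_addRec {p q : List (List ℕ)} (h : p.map List.length = q.map List.length)
    {k : ℕ} (hne : ∀ r ∈ q, r ≠ []) (hlt : ∀ r ∈ q, ∀ a ∈ r, a < k) (x : ℕ) :
    eraseLabel k (addRec q ((insertT p x).map List.length) k) = q := by
  induction p generalizing q x with
  | nil =>
    cases q with
    | nil => simp [addRec, eraseLabel]
    | cons s q => simp at h
  | cons r p ih =>
    cases q with
    | nil => simp at h
    | cons s q =>
      simp only [List.map_cons, List.cons.injEq] at h
      have hs := filter_ne_eq_self (hlt s (by simp))
      have hne' : ∀ r ∈ q, r ≠ [] := fun r hr => hne r (by simp [hr])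
      have hlt' : ∀ r ∈ q, ∀ a ∈ r, a < k := fun r hr => hlt r (by simp [hr])
      rcases h1 : insRow r x with ⟨r', _ | b⟩
      · simp only [insertT, h1, addRec, insRow_eq_none h1, h, List.map_cons, List.length_append,
          List.length_singleton, Nat.lt_succ_self, if_true]
        rw [eraseLabel_cons, List.filter_append, hs, eraseLabel_eq_self hne' hlt']
        simp [hne s (by simp)]
      · simp only [insertT, h1, addRec, length_insRow_some h1, h, List.map_cons, lt_irrefl,
          if_false]
        rw [eraseLabel_cons, hs, if_neg (hne s (by simp)), ih h.2 hne' hlt']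

theorem RS_invariants (w : List ℕ) :
    (RS w).1.map List.length = (RS w).2.map List.length ∧
    (∀ r ∈ (RS w).1, r.Pairwise (· ≤ ·)) ∧
    (∀ r ∈ (RS w).2, r ≠ []) ∧
    (∀ r ∈ (RS w).2, ∀ a ∈ r, a < w.length + 1) := by
  induction w using List.reverseRecOn with
  | nil => simp [RS_nil]
  | append_singleton w x ih =>
    obtain ⟨h1, h2, h3, h4⟩ := ih
    rw [RS_concat]
    refine ⟨(map_length_addRec h1 _ _).symm, pairwise_insertT h2 x, fun r hr => ?_,
      fun r hr a ha => ?_⟩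
    · rcases mem_addRec h1 hr with hr | rfl | ⟨s, -, rfl⟩
      · exact h3 r hr
      · simp
      · simp
    · rw [List.length_append, List.length_singleton]
      rcases mem_addRec h1 hr with hr | rfl | ⟨s, hs, rfl⟩
      · exact (h4 r hr a ha).trans (Nat.lt_succ_self _)
      · rw [List.mem_singleton] at ha
        omega
      · rw [List.mem_append, List.mem_singleton] at ha
        rcases ha with ha | ha
        · exact (h4 s hs a ha).trans (Nat.lt_succ_self _)
        · omega

theorem RS_injective {w w' : List ℕ} (hlen : w.length = w'.length) (h : RS w = RS w') :
    w = w' := by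
  induction w using List.reverseRecOn generalizing w' with
  | nil => exact (List.length_eq_zero_iff.mp hlen.symm).symm
  | append_singleton w x ih =>
    rcases List.eq_nil_or_concat w' with rfl | ⟨w', y, rfl⟩
    · simp at hlen
    · rw [List.concat_eq_append] at *
      have hlen' : w.length = w'.length := by simpa using hlen
      rw [RS_concat, RS_concat, Prod.mk.injEq] at h
      obtain ⟨hP, hQ⟩ := h
      obtain ⟨a1, a2, a3, a4⟩ := RS_invariants w
      obtain ⟨b1, b2, b3, b4⟩ := RS_invariants w'
      have hQ' : (RS w).2 = (RS w').2 := by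
        rw [← eraseLabel_addRec a1 a3 a4 x, hQ, hlen', eraseLabel_addRec b1 b3 b4]
      obtain ⟨hP', rfl⟩ := insertT_injective a2 b2 (by rw [a1, b1, hQ']) hP
      rw [ih hlen' (Prod.ext hP' hQ')]

/-! ### Tableaux as sequences of columns -/

/-- The `j`-th column of the tableau `t` of shape `l`, from top to bottom. -/
def colOf (l : List ℕ) (t : List (List ℕ)) (j : ℕ) : List ℕ :=
  (List.range (conjC l j)).map fun i => (t.getD i []).getD j 0

/-- The column reading word of the first `J` columns of `t`: the columns are read from left to
right, each of them from bottom to top. -/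
def colWord (l : List ℕ) (t : List (List ℕ)) : ℕ → List ℕ
  | 0 => []
  | J + 1 => colWord l t J ++ (colOf l t J).reverse

/-- The first `J` columns of the tableau `t` of shape `l`. -/
def firstCols (l : List ℕ) (t : List (List ℕ)) : ℕ → List (List ℕ)
  | 0 => []
  | J + 1 => glue (firstCols l t J) (colOf l t J)

theorem length_colOf (l : List ℕ) (t : List (List ℕ)) (j : ℕ) :
    (colOf l t j).length = conjC l j := by
  simp [colOf]

theorem length_colWord (l : List ℕ) (t : List (List ℕ)) (J : ℕ) :
    (colWord l t J).length = colStart l J := by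
  induction J with
  | zero => rfl
  | succ J ih => simp [colWord, ih, colStart_succ, length_colOf]

theorem length_getD_of_shape {l : List ℕ} {t : List (List ℕ)} (ht : t.map List.length = l)
    (i : ℕ) : (t.getD i []).length = l.getD i 0 := by
  subst ht
  by_cases hi : i < t.length
  · rw [List.getD_eq_getElem _ _ hi, List.getD_eq_getElem _ _ (by simpa using hi),
      List.getElem_map]
  · rw [List.getD_eq_default _ _ (not_lt.mp hi), List.getD_eq_default _ _ (by simpa using hi)]
    rfl

theorem getElem?_colOf {l : List ℕ} {t : List (List ℕ)} (hl : l.Pairwise (· ≥ ·))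
    (ht : t.map List.length = l) (i j : ℕ) : (colOf l t j)[i]? = (t.getD i [])[j]? := by
  have h1 := lt_conjC_iff hl i j
  rw [← length_getD_of_shape ht] at h1
  by_cases hi : i < conjC l j
  · have hj := h1.mp hi
    rw [List.getElem?_eq_getElem hj, List.getElem?_eq_getElem (by rwa [length_colOf])]
    simp only [colOf, List.getElem_map, List.getElem_range]
    rw [List.getD_eq_getElem _ _ hj]
  · rw [List.getElem?_eq_none (by rw [length_colOf]; omega),
      List.getElem?_eq_none (by omega)]

theorem getD_firstCols {l : List ℕ} {t : List (List ℕ)} (hl : l.Pairwise (· ≥ ·))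
    (ht : t.map List.length = l) (J i : ℕ) :
    (firstCols l t J).getD i [] = (t.getD i []).take J := by
  induction J with
  | zero => simp [firstCols]
  | succ J ih => rw [firstCols, getD_glue, ih, getElem?_colOf hl ht, List.take_add_one]

theorem length_firstCols (l : List ℕ) (t : List (List ℕ)) {J : ℕ} (hl : l.Pairwise (· ≥ ·)) :
    (firstCols l t (J + 1)).length = conjC l 0 := by
  have hle : ∀ j, conjC l j ≤ conjC l 0 := by
    intro j
    by_contra! h
    have h1 := (lt_conjC_iff hl _ _).mp h
    have h2 := (lt_conjC_iff hl (conjC l 0) 0).mpr (by omega)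
    omega
  induction J with
  | zero => simp [firstCols, length_glue, length_colOf]
  | succ J ih =>
    rw [firstCols, length_glue, ih, length_colOf]
    exact max_eq_left (hle _)

theorem conjC_zero {l : List ℕ} (hpos : ∀ x ∈ l, 0 < x) : conjC l 0 = l.length := by
  unfold conjC
  rw [List.filter_eq_self.mpr fun a ha => by simpa using hpos a ha]

theorem firstCols_eq_self {l : List ℕ} {t : List (List ℕ)} {N : ℕ} (hl : l.Pairwise (· ≥ ·))
    (hpos : ∀ x ∈ l, 0 < x) (ht : t.map List.length = l) (hN : ∀ x ∈ l, x ≤ N) :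
    firstCols l t N = t := by
  have hlen : (firstCols l t N).length = t.length := by
    cases N with
    | zero =>
      cases l with
      | nil =>
        simp only [List.map_eq_nil_iff] at ht
        simp [ht, firstCols]
      | cons a l => exact absurd (hpos a (by simp)) (by have := hN a (by simp); omega)
    | succ N => rw [length_firstCols l t hl, conjC_zero hpos, ← ht, List.length_map]
  refine List.ext_getElem hlen fun i h1 h2 => ?_
  have := getD_firstCols hl ht N i
  rw [List.getD_eq_getElem _ _ h1, List.getD_eq_getElem _ _ h2] at this
  rw [this, List.take_of_length_le]
  exact hN _ (ht ▸ List.mem_map_of_mem (List.getElem_mem h2))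

theorem firstCols_congr {l : List ℕ} {t t' : List (List ℕ)} {J : ℕ}
    (h : colWord l t J = colWord l t' J) : firstCols l t J = firstCols l t' J := by
  induction J with
  | zero => rfl
  | succ J ih =>
    obtain ⟨h1, h2⟩ := List.append_inj h (by rw [length_colWord, length_colWord])
    rw [firstCols, firstCols, ih h1, List.reverse_injective h2]

theorem isChain_colOf {l : List ℕ} {t : List (List ℕ)} (hl : l.Pairwise (· ≥ ·))
    (ht : t.map List.length = l) (hstd : standardL t) (j : ℕ) :
    (colOf l t j).IsChain (· < ·) := by
  rw [List.isChain_iff_getElem]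
  intro i hi
  simp only [colOf, List.getElem_map, List.getElem_range]
  rw [length_colOf, lt_conjC_iff hl, ← length_getD_of_shape ht] at hi
  refine hstd.2 i j ?_ hi
  by_contra h
  rw [List.getD_eq_default _ _ (not_lt.mp h)] at hi
  simp at hi

theorem rowsLtCol_firstCols {l : List ℕ} {t : List (List ℕ)} (hl : l.Pairwise (· ≥ ·))
    (ht : t.map List.length = l) (hstd : standardL t) (J : ℕ) :
    RowsLtCol (firstCols l t J) (colOf l t J) := by
  intro i d hd a ha
  rw [getElem?_colOf hl ht] at hd
  rw [getD_firstCols hl ht] at ha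
  obtain ⟨hJ, rfl⟩ := List.getElem?_eq_some_iff.mp hd
  obtain ⟨k, hk, rfl⟩ := List.mem_take_iff_getElem.mp ha
  have hi : i < t.length := by
    by_contra h
    rw [List.getD_eq_default _ _ (not_lt.mp h)] at hJ
    simp at hJ
  have hrow : (t.getD i []).Pairwise (· < ·) := by
    rw [List.getD_eq_getElem _ _ hi]
    exact List.isChain_iff_pairwise.mp (hstd.1 _ (List.getElem_mem hi))
  exact List.pairwise_iff_getElem.mp hrow _ _ _ _ (by omega)

theorem map_length_tabColList (l : List ℕ) : (tabColList l).map List.length = l := by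
  refine List.ext_getElem (by simp [tabColList]) fun i h1 h2 => ?_
  simp [tabColList, h2]

theorem getD_tabColList {l : List ℕ} {i j : ℕ} (hj : j < l.getD i 0) :
    ((tabColList l).getD i []).getD j 0 = colStart l j + i + 1 := by
  have hi : i < l.length := by
    by_contra h
    rw [List.getD_eq_default _ _ (not_lt.mp h)] at hj
    simp at hj
  rw [List.getD_eq_getElem (tabColList l) _ (by simpa [tabColList] using hi)]
  simp only [tabColList, List.getElem_map, List.getElem_range]
  rw [List.getD_eq_getElem _ _ (by simpa using hj)]
  simp

theorem colOf_tabColList {l : List ℕ} (hl : l.Pairwise (· ≥ ·)) (j : ℕ) :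
    colOf l (tabColList l) j = (List.range (conjC l j)).map fun i => colStart l j + i + 1 := by
  refine List.map_congr_left fun i hi => getD_tabColList ?_
  exact (lt_conjC_iff hl i j).mp (List.mem_range.mp hi)

theorem map_length_firstCols (l : List ℕ) (t t' : List (List ℕ)) (J : ℕ) :
    (firstCols l t J).map List.length = (firstCols l t' J).map List.length := by
  induction J with
  | zero => rfl
  | succ J ih => exact map_length_glue ih (by rw [length_colOf, length_colOf])

theorem RS_colWord {l : List ℕ} {t : List (List ℕ)} (hl : l.Pairwise (· ≥ ·))
    (ht : t.map List.length = l) (hstd : standardL t) (J : ℕ) :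
    RS (colWord l t J) = (firstCols l t J, firstCols l (tabColList l) J) := by
  induction J with
  | zero => rfl
  | succ J ih =>
    rw [colWord, RS_append_column ih (map_length_firstCols l _ _ J)
      (rowsLtCol_firstCols hl ht hstd J) (isChain_colOf hl ht hstd J), firstCols, firstCols,
      length_colWord, length_colOf, colOf_tabColList hl]

theorem RS_colWord_eq {l : List ℕ} {t : List (List ℕ)} {N : ℕ} (hl : l.Pairwise (· ≥ ·))
    (hpos : ∀ x ∈ l, 0 < x) (ht : t.map List.length = l) (hN : ∀ x ∈ l, x ≤ N)
    (hstd : standardL t) : RS (colWord l t N) = (t, tabColList l) := by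
  rw [RS_colWord hl ht hstd, firstCols_eq_self hl hpos ht hN,
    firstCols_eq_self hl hpos (map_length_tabColList l) hN]

theorem colWord_injective {l : List ℕ} {t t' : List (List ℕ)} {N : ℕ} (hl : l.Pairwise (· ≥ ·))
    (hpos : ∀ x ∈ l, 0 < x) (ht : t.map List.length = l) (ht' : t'.map List.length = l)
    (hN : ∀ x ∈ l, x ≤ N) (h : colWord l t N = colWord l t' N) : t = t' := by
  rw [← firstCols_eq_self hl hpos ht hN, firstCols_congr h, firstCols_eq_self hl hpos ht' hN]

/-! ### The longest element of the column stabilizer -/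

theorem lt_colStart_iff_of_mem_closure {n : ℕ} {l : List ℕ} {u : Equiv.Perm (Fin n)}
    (hu : u ∈ Subgroup.closure (JlambdaL n l)) (j : ℕ) (m : Fin n) :
    (u m : ℕ) < colStart l j ↔ (m : ℕ) < colStart l j := by
  induction hu using Subgroup.closure_induction generalizing m with
  | mem σ hσ =>
    obtain ⟨k, hk, ⟨i, hi1, hi2⟩, rfl⟩ := hσ
    have hkj : k + 1 < colStart l j ↔ k < colStart l j := by
      rcases Nat.lt_or_ge i j with hij | hij
      · have := colStart_mono l (Nat.succ_le_of_lt hij)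
        simp only [Nat.succ_eq_add_one] at this
        omega
      · have := colStart_mono l hij
        omega
    rw [Equiv.swap_apply_def]
    split_ifs with h1 h2
    · subst h1; exact hkj
    · subst h2; exact hkj.symm
    · rfl
  | one => rfl
  | mul u v _ _ hu hv => rw [Equiv.Perm.mul_apply, hu, hv]
  | inv u _ hu => rw [← hu, ← Equiv.Perm.mul_apply, mul_inv_cancel, Equiv.Perm.one_apply]

theorem invLen_lt_mul_swap {n : ℕ} (u : Equiv.Perm (Fin n)) {a b : Fin n}
    (hab : (b : ℕ) = a + 1) (h : u a < u b) : invLen u < invLen (u * Equiv.swap a b) := by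
  have hne : a ≠ b := fun h => by rw [h] at hab; omega
  set s := Equiv.swap a b
  have hsa : s a = b := Equiv.swap_apply_left a b
  have hsb : s b = a := Equiv.swap_apply_right a b
  have hs : ∀ x, s (s x) = x := Equiv.swap_apply_self a b
  let f : Fin n × Fin n ↪ Fin n × Fin n := (s.prodCongr s).toEmbedding
  unfold invLen
  rw [← Finset.card_map f]
  refine Finset.card_lt_card ((Finset.ssubset_iff_of_subset ?_).mpr ⟨(a, b), ?_, ?_⟩)
  · intro p hp
    rw [Finset.mem_map] at hp
    obtain ⟨⟨x, y⟩, hxy, rfl⟩ := hp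
    simp only [Finset.mem_filter, Finset.mem_univ, true_and] at hxy
    simp only [f, Equiv.toEmbedding_apply, Equiv.prodCongr_apply, Prod.map_apply]
    rw [Finset.mem_filter]
    simp only [Equiv.Perm.mul_apply, hs]
    refine ⟨Finset.mem_univ _, ?_, hxy.2⟩
    obtain ⟨h1, h2⟩ := hxy
    have hn : ¬ (x = a ∧ y = b) := by
      rintro ⟨rfl, rfl⟩
      exact lt_asymm h h2
    simp only [s, Equiv.swap_apply_def]
    split_ifs <;> simp only [Fin.ext_iff, Fin.lt_def] at * <;> omega
  · rw [Finset.mem_filter]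
    simp only [Equiv.Perm.mul_apply, hsa, hsb]
    exact ⟨Finset.mem_univ _, by rw [Fin.lt_def]; omega, h⟩
  · rw [Finset.mem_map]
    rintro ⟨⟨x, y⟩, hxy, he⟩
    simp only [Finset.mem_filter, Finset.mem_univ, true_and] at hxy
    simp only [f, Equiv.toEmbedding_apply, Equiv.prodCongr_apply, Prod.map_apply,
      Prod.mk.injEq] at he
    have hx : x = b := by rw [← hs x, he.1, hsa]
    have hy : y = a := by rw [← hs y, he.2, hsb]
    subst hx hy
    have := hxy.1
    rw [Fin.lt_def] at this
    omega

theorem longest_apply {n : ℕ} {l : List ℕ} {wJ : Equiv.Perm (Fin n)}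
    (hmem : wJ ∈ Subgroup.closure (JlambdaL n l))
    (hlong : ∀ u ∈ Subgroup.closure (JlambdaL n l), invLen u ≤ invLen wJ)
    {j i : ℕ} (hi : i < conjC l j) (hn : colStart l j + i < n)
    (hJn : colStart l (j + 1) ≤ n) :
    (wJ ⟨colStart l j + i, hn⟩ : ℕ) = colStart l j + (conjC l j - 1 - i) := by
  rw [colStart_succ] at hJn
  have hblock : ∀ (k : ℕ) (hk : k < conjC l j),
      colStart l j ≤ (wJ ⟨colStart l j + k, by omega⟩ : ℕ) ∧
        (wJ ⟨colStart l j + k, by omega⟩ : ℕ) < colStart l j + conjC l j := by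
    intro k hk
    have h1 := lt_colStart_iff_of_mem_closure hmem j ⟨colStart l j + k, by omega⟩
    have h2 := lt_colStart_iff_of_mem_closure hmem (j + 1) ⟨colStart l j + k, by omega⟩
    rw [colStart_succ] at h2
    simp only at h1 h2
    omega
  have hdesc : ∀ (k : ℕ) (hk : k + 1 < conjC l j),
      (wJ ⟨colStart l j + (k + 1), by omega⟩ : ℕ) < wJ ⟨colStart l j + k, by omega⟩ := by
    intro k hk
    by_contra! hle
    have hne : wJ ⟨colStart l j + k, by omega⟩ ≠ wJ ⟨colStart l j + (k + 1), by omega⟩ :=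
      fun h => by simpa using wJ.injective h
    have hlt := lt_of_le_of_ne (Fin.le_def.mpr hle) hne
    refine (invLen_lt_mul_swap wJ ?_ hlt).not_ge (hlong _ (mul_mem hmem (Subgroup.subset_closure
      ⟨colStart l j + k, by omega, ⟨j, by omega, ?_⟩, rfl⟩)))
    · simp only [Nat.add_assoc]
    · rw [colStart_succ]; omega
  have hup : ∀ (k : ℕ) (hk : k < conjC l j),
      (wJ ⟨colStart l j + k, by omega⟩ : ℕ) + k < colStart l j + conjC l j := by
    intro k
    induction k with
    | zero => intro hk; exact (hblock 0 hk).2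
    | succ k ih =>
      intro hk
      have := ih (by omega)
      have := hdesc k hk
      omega
  have hdown : ∀ (k : ℕ) (hk : k < conjC l j),
      colStart l j + k ≤ (wJ ⟨colStart l j + (conjC l j - 1 - k), by omega⟩ : ℕ) := by
    intro k
    induction k with
    | zero => intro hk; exact (hblock _ (by omega)).1
    | succ k ih =>
      intro hk
      have h1 := ih (by omega)
      have h2 := hdesc (conjC l j - 1 - (k + 1)) (by omega)
      have h3 : conjC l j - 1 - (k + 1) + 1 = conjC l j - 1 - k := by omega
      simp only [h3] at h2
      omega
  have h1 := hup i hi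
  have h2 := hdown (conjC l j - 1 - i) (by omega)
  have h3 : conjC l j - 1 - (conjC l j - 1 - i) = i := by omega
  simp only [h3] at h2
  omega

/-! ### Words of permutations as column reading words -/

theorem map_length_actL {n : ℕ} (v : Equiv.Perm (Fin n)) (t : List (List ℕ)) :
    (actL v t).map List.length = t.map List.length := by
  simp [actL, Function.comp_def]

theorem getD_actL_tabColList {n : ℕ} {l : List ℕ} (v : Equiv.Perm (Fin n)) {i j : ℕ}
    (hj : j < l.getD i 0) (hn : colStart l j + i < n) :
    ((actL v (tabColList l)).getD i []).getD j 0 = (v ⟨colStart l j + i, hn⟩ : ℕ) + 1 := by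
  have h1 := getD_tabColList hj
  rw [← length_getD_of_shape (map_length_tabColList l)] at hj
  have hi : i < (tabColList l).length := by
    by_contra h
    rw [List.getD_eq_default _ _ (not_lt.mp h)] at hj
    simp at hj
  simp only [List.getD_eq_getElem _ _ hi] at h1 hj
  rw [List.getD_eq_getElem _ _ hj] at h1
  rw [List.getD_eq_getElem (actL v (tabColList l)) _ (by simpa [actL] using hi)]
  simp only [actL, List.getElem_map]
  rw [List.getD_eq_getElem _ _ (by simpa using hj)]
  simp [h1, hn]

theorem wordOf_eq_map_range {n : ℕ} (w : Equiv.Perm (Fin n)) :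
    wordOf w = (List.range n).map fun m => if h : m < n then (w ⟨m, h⟩ : ℕ) + 1 else 0 := by
  refine List.ext_getElem (by simp [wordOf]) fun m h1 h2 => ?_
  have hm : m < n := by simpa using h2
  simp [wordOf, hm]

theorem wordOf_mul_longest {n : ℕ} {l : List ℕ} {N : ℕ} (hl : l.Pairwise (· ≥ ·))
    (hN : colStart l N = n) {wJ : Equiv.Perm (Fin n)}
    (hmem : wJ ∈ Subgroup.closure (JlambdaL n l))
    (hlong : ∀ u ∈ Subgroup.closure (JlambdaL n l), invLen u ≤ invLen wJ)
    (v : Equiv.Perm (Fin n)) :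
    wordOf (v * wJ) = colWord l (actL v (tabColList l)) N := by
  rw [wordOf_eq_map_range]
  set f : ℕ → ℕ := fun m => if h : m < n then ((v * wJ) ⟨m, h⟩ : ℕ) + 1 else 0 with hf
  suffices h : ∀ J ≤ N,
      (List.range (colStart l J)).map f = colWord l (actL v (tabColList l)) J by
    rw [← h N le_rfl, hN]
  intro J hJ
  induction J with
  | zero => rfl
  | succ J ih =>
    have hJn : colStart l (J + 1) ≤ n := hN ▸ colStart_mono l hJ
    have hJn' := hJn
    rw [colStart_succ] at hJn'
    rw [colStart_succ, List.range_add, List.map_append, ih (by omega), colWord]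
    congr 1
    refine List.ext_getElem (by simp [length_colOf]) fun i h1 h2 => ?_
    have hi : i < conjC l J := by simpa using h1
    have hin : colStart l J + i < n := by omega
    rw [List.getElem_reverse]
    simp only [colOf, List.getElem_map, List.getElem_range, List.length_map, List.length_range]
    rw [getD_actL_tabColList v ((lt_conjC_iff hl _ _).mp (by omega)) (by omega), hf]
    simp only [hin, dif_pos, Equiv.Perm.mul_apply]
    congr 3
    exact Fin.ext (longest_apply hmem hlong hi hin hJn)

/-- Let `w_J` be the longest element of the column stabilizer `W_{J_λ}`.  Then
`RS(w) = (t, tab_λ)` for some standard tableau `t` of shape `λ` if and only if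
`w = v·w_J` for some `v` with `v·tab_λ` standard; and in that case
`t = P(w) = v·tab_λ`. -/
theorem RS_recording_eq_tabCol_iff (n : ℕ) (l : List ℕ)
    (hsort : l.Chain' (· ≥ ·)) (hpos : ∀ x ∈ l, 0 < x) (hsum : l.sum = n)
    (wJ : Equiv.Perm (Fin n))
    (hwJmem : wJ ∈ Subgroup.closure (JlambdaL n l))
    (hwJlong : ∀ u ∈ Subgroup.closure (JlambdaL n l), invLen u ≤ invLen wJ)
    (w : Equiv.Perm (Fin n)) :
    ((∃ t : List (List ℕ), standardL t ∧ t.map List.length = l ∧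
        RS (wordOf w) = (t, tabColList l)) ↔
      (∃ v : Equiv.Perm (Fin n), w = v * wJ ∧ standardL (actL v (tabColList l)))) ∧
    (∀ v : Equiv.Perm (Fin n), w = v * wJ → standardL (actL v (tabColList l)) →
      (RS (wordOf w)).1 = actL v (tabColList l)) := by
  have hl : l.Pairwise (· ≥ ·) := List.isChain_iff_pairwise.mp hsort
  obtain ⟨N, hN⟩ : ∃ N, ∀ x ∈ l, x ≤ N := ⟨l.sum, fun x hx => List.le_sum_of_mem hx⟩
  have hcol : colStart l N = n := (colStart_eq_sum hN).trans hsum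
  have hword := wordOf_mul_longest hl hcol hwJmem hwJlong
  have hshape : ∀ v : Equiv.Perm (Fin n), (actL v (tabColList l)).map List.length = l :=
    fun v => (map_length_actL v _).trans (map_length_tabColList l)
  have hRS : ∀ v : Equiv.Perm (Fin n), standardL (actL v (tabColList l)) →
      RS (wordOf (v * wJ)) = (actL v (tabColList l), tabColList l) := fun v hv => by
    rw [hword, RS_colWord_eq hl hpos (hshape v) hN hv]
  refine ⟨⟨?_, ?_⟩, ?_⟩
  · rintro ⟨t, hstd, ht, hw⟩
    refine ⟨w * wJ⁻¹, by simp, ?_⟩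
    have h1 : wordOf w = colWord l t N := by
      refine RS_injective ?_ (hw.trans (RS_colWord_eq hl hpos ht hN hstd).symm)
      rw [length_colWord, hcol]
      simp [wordOf]
    have h2 := hword (w * wJ⁻¹)
    rw [inv_mul_cancel_right, h1] at h2
    rwa [← colWord_injective hl hpos ht (hshape _) hN h2]
  · rintro ⟨v, rfl, hv⟩
    exact ⟨_, hv, hshape v, hRS v hv⟩
  · rintro v rfl hv
    rw [hRS v hv]
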